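/- (Existence of the higher-order singular value decomposition.) Let X be an order-D real tensor. Then there exist orthogonal matrices U^(d) ∈ ℝ^{n_d × n_d} for d = 1,…,D such that, setting S = X ×_1 (U^(1))ᵀ ⋯ ×_D (U^(D))ᵀ, one has X = S ×_1 U^(1) ⋯ ×_D U^(D), and for every mode d: the subtensors S_{i_d = k} (obtained from S by fixing the d-th coordinate to k) are pairwise orthogonal, i.e. ⟨S_{i_d = k}, S_{i_d = k'}⟩ = 0 for k ≠ k', and the Frobenius norm of S_{i_d = k} equals the k-th mode-d singular value of X: ‖S_{i_d = k}‖ = σ^(d)_k(X) for all k = 1,…,n_d. -/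

import Mathlib

open scoped BigOperators Matrix

/-- The entries of `v` sorted in nonincreasing order. -/
noncomputable def sortDesc {m : ℕ} (v : Fin m → ℝ) : Fin m → ℝ :=
  fun k => (v ∘ Tuple.sort v) k.rev

theorem gram_isHermitian {m : ℕ} {J : Type*} [Fintype J]
    (A : Matrix (Fin m) J ℝ) : (A * Aᵀ).IsHermitian := by
  ext i j
  simp [Matrix.conjTranspose_apply, Matrix.mul_apply, Matrix.transpose_apply, mul_comm]

/-- Singular values of a real matrix `A`: the square roots of the eigenvalues of
the positive semidefinite matrix `A * Aᵀ`, in nonincreasing order. -/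
noncomputable def singularValues {m : ℕ} {J : Type*} [Fintype J]
    (A : Matrix (Fin m) J ℝ) : Fin m → ℝ :=
  fun k => Real.sqrt (sortDesc (gram_isHermitian A).eigenvalues k)

variable {D : ℕ} {n : Fin D → ℕ}

/-- Inner product of two tensors. -/
noncomputable def tinner (X Y : (∀ d, Fin (n d)) → ℝ) : ℝ :=
  ∑ i : ∀ d, Fin (n d), X i * Y i

/-- Mode-`d` matricization of the tensor `X`. -/
def matricize (X : (∀ d, Fin (n d)) → ℝ) (d : Fin D) :
    Matrix (Fin (n d)) (∀ d' : {d' : Fin D // d' ≠ d}, Fin (n d')) ℝ :=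
  Matrix.of fun k j =>
    X (fun d' => if h : d' = d then Fin.cast (congrArg n h.symm) k else j ⟨d', h⟩)

/-- Mode-`d` singular values of a tensor. -/
noncomputable def modeSV (X : (∀ d, Fin (n d)) → ℝ) (d : Fin D) : Fin (n d) → ℝ :=
  singularValues (matricize X d)

/-- The multilinear (Tucker) product `X ×₁ U 1 ×₂ ⋯ ×_D U D`. -/
noncomputable def tuckerMul (X : (∀ d, Fin (n d)) → ℝ)
    (U : ∀ d, Matrix (Fin (n d)) (Fin (n d)) ℝ) : (∀ d, Fin (n d)) → ℝ :=
  fun i => ∑ j : ∀ d, Fin (n d), (∏ d, U d (i d) (j d)) * X j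

/-- Rectangular "diagonal" matrix with columns indexed by an arbitrary fintype,
identified with an initial segment of `ℕ` via `Fintype.equivFin`. -/
noncomputable def rectDiagJ {m : ℕ} {J : Type*} [Fintype J]
    (v : Fin m → ℝ) : Matrix (Fin m) J ℝ :=
  Matrix.of fun k j => if ((Fintype.equivFin J) j : ℕ) = (k : ℕ) then v k else 0

/-- The Kronecker product of a family of matrices, indexed by dependent functions. -/
def piKron {ι R : Type*} [Fintype ι] [CommSemiring R] {α β : ι → Type*}
    (V : ∀ d, Matrix (α d) (β d) R) : Matrix (∀ d, α d) (∀ d, β d) R :=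
  Matrix.of fun i j => ∏ d, V d (i d) (j d)

section PiKron

variable {ι R : Type*} [Fintype ι] [CommSemiring R] {α β γ : ι → Type*}

theorem piKron_mul [DecidableEq ι] [∀ d, Fintype (β d)]
    (V : ∀ d, Matrix (α d) (β d) R) (W : ∀ d, Matrix (β d) (γ d) R) :
    piKron V * piKron W = piKron fun d => V d * W d := by
  ext i j
  simp only [piKron, Matrix.mul_apply, Matrix.of_apply, ← Finset.prod_mul_distrib]
  rw [Finset.prod_univ_sum, Fintype.piFinset_univ]

theorem piKron_one [∀ d, DecidableEq (α d)] [DecidableEq (∀ d, α d)] :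
    piKron (fun d => (1 : Matrix (α d) (α d) R)) = 1 := by
  ext i j
  by_cases h : i = j
  · subst h
    simp [piKron]
  · obtain ⟨d, hd⟩ := Function.ne_iff.mp h
    rw [Matrix.one_apply_ne h]
    exact Finset.prod_eq_zero (Finset.mem_univ d) (Matrix.one_apply_ne hd)

theorem piKron_transpose (V : ∀ d, Matrix (α d) (β d) R) :
    (piKron V)ᵀ = piKron fun d => (V d)ᵀ :=
  rfl

end PiKron

theorem tuckerMul_eq_mulVec (X : (∀ d, Fin (n d)) → ℝ)
    (V : ∀ d, Matrix (Fin (n d)) (Fin (n d)) ℝ) : tuckerMul X V = piKron V *ᵥ X :=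
  rfl

theorem tuckerMul_tuckerMul (X : (∀ d, Fin (n d)) → ℝ)
    (V W : ∀ d, Matrix (Fin (n d)) (Fin (n d)) ℝ) :
    tuckerMul (tuckerMul X V) W = tuckerMul X fun d => W d * V d := by
  simp only [tuckerMul_eq_mulVec, Matrix.mulVec_mulVec, piKron_mul]

theorem matricize_apply (X : (∀ d, Fin (n d)) → ℝ) (d : Fin D) (k : Fin (n d))
    (j : ∀ d' : {d' : Fin D // d' ≠ d}, Fin (n d')) :
    matricize X d k j = X ((Equiv.piSplitAt d fun d => Fin (n d)).symm (k, j)) := by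
  rw [matricize, Matrix.of_apply]
  congr 1
  funext d'
  rw [Equiv.piSplitAt_symm_apply]
  split_ifs with h
  · subst h
    rfl
  · rfl

theorem matricize_tuckerMul (X : (∀ d, Fin (n d)) → ℝ)
    (V : ∀ d, Matrix (Fin (n d)) (Fin (n d)) ℝ) (d : Fin D) :
    matricize (tuckerMul X V) d = V d * matricize X d *
      (piKron fun d' : {d' : Fin D // d' ≠ d} => V d')ᵀ := by
  ext k j
  rw [matricize_apply, tuckerMul, Matrix.mul_assoc, Matrix.mul_apply,
    ← (Equiv.piSplitAt d fun d => Fin (n d)).symm.sum_comp, Fintype.sum_prod_type]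
  refine Finset.sum_congr rfl fun k' _ => ?_
  rw [Matrix.mul_apply, Finset.mul_sum]
  refine Finset.sum_congr rfl fun j' _ => ?_
  rw [matricize_apply, Fintype.prod_eq_mul_prod_subtype_ne _ d]
  have h : ∀ d' : {d' : Fin D // d' ≠ d}, V d'
      ((Equiv.piSplitAt d fun d => Fin (n d)).symm (k, j) d')
      ((Equiv.piSplitAt d fun d => Fin (n d)).symm (k', j') d') = V d' (j d') (j' d') :=
    fun d' => by simp [d'.2]
  simp only [h, Matrix.transpose_apply, piKron, Matrix.of_apply]
  simp only [Equiv.piSplitAt_symm_apply, dite_true]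
  ring

theorem matricize_tuckerMul_gram (X : (∀ d, Fin (n d)) → ℝ)
    (V : ∀ d, Matrix (Fin (n d)) (Fin (n d)) ℝ) (hV : ∀ d, (V d)ᵀ * V d = 1) (d : Fin D) :
    matricize (tuckerMul X V) d * (matricize (tuckerMul X V) d)ᵀ =
      V d * (matricize X d * (matricize X d)ᵀ) * (V d)ᵀ := by
  have hK : (piKron fun d' : {d' : Fin D // d' ≠ d} => V d')ᵀ *
      (piKron fun d' : {d' : Fin D // d' ≠ d} => V d') = 1 := by
    rw [piKron_transpose, piKron_mul]
    simp only [hV]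
    exact piKron_one
  rw [matricize_tuckerMul]
  generalize (piKron fun d' : {d' : Fin D // d' ≠ d} => V d') = K at hK
  simp only [Matrix.transpose_mul, Matrix.transpose_transpose, Matrix.mul_assoc]
  rw [← Matrix.mul_assoc Kᵀ, hK, Matrix.one_mul]

/-- Orthogonal diagonalization of a real symmetric matrix with the eigenvalues in nonincreasing
order. -/
theorem exists_orthogonal_diagonal_sortDesc {m : ℕ} {A : Matrix (Fin m) (Fin m) ℝ}
    (hA : A.IsHermitian) :
    ∃ U : Matrix (Fin m) (Fin m) ℝ, U * Uᵀ = 1 ∧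
      Uᵀ * A * U = Matrix.diagonal (sortDesc hA.eigenvalues) := by
  let e : Equiv.Perm (Fin m) := Fin.revPerm.trans (Tuple.sort hA.eigenvalues)
  let E : Matrix (Fin m) (Fin m) ℝ := hA.eigenvectorUnitary
  have hE : E * Eᵀ = 1 := Unitary.coe_mul_star_self hA.eigenvectorUnitary
  have hD : Eᵀ * A * E = Matrix.diagonal hA.eigenvalues := by
    have h := hA.conjStarAlgAut_star_eigenvectorUnitary
    rw [Unitary.conjStarAlgAut_star_apply] at h
    exact h
  refine ⟨E.submatrix id e, ?_, ?_⟩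
  · rw [Matrix.transpose_submatrix, Matrix.submatrix_mul_equiv, hE, Matrix.submatrix_id_id]
  · have h := congrArg (fun M => M.submatrix e e) hD
    simp only [Matrix.submatrix_diagonal_equiv] at h
    exact h

/-- existence of the higher-order singular value decomposition. -/
theorem exists_HOSVD (D : ℕ) (hD : 1 ≤ D) (n : Fin D → ℕ)
    (X : (∀ d, Fin (n d)) → ℝ) :
    ∃ (U : ∀ d, Matrix (Fin (n d)) (Fin (n d)) ℝ)
      (S : (∀ d, Fin (n d)) → ℝ),
      (∀ d, U d * (U d)ᵀ = 1) ∧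
      S = tuckerMul X (fun d => (U d)ᵀ) ∧
      X = tuckerMul S U ∧
      (∀ (d : Fin D) (k k' : Fin (n d)), k ≠ k' →
        ∑ j, matricize S d k j * matricize S d k' j = 0) ∧
      (∀ (d : Fin D) (k : Fin (n d)),
        Real.sqrt (∑ j, (matricize S d k j) ^ 2) = modeSV X d k) := by
  choose U hU hUD using fun d => exists_orthogonal_diagonal_sortDesc
    (gram_isHermitian (matricize X d))
  have hG : ∀ d, matricize (tuckerMul X fun d => (U d)ᵀ) d *
      (matricize (tuckerMul X fun d => (U d)ᵀ) d)ᵀ =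
      Matrix.diagonal (sortDesc (gram_isHermitian (matricize X d)).eigenvalues) := fun d => by
    rw [matricize_tuckerMul_gram _ _ (fun d => by simpa using hU d), Matrix.transpose_transpose,
      hUD]
  refine ⟨U, tuckerMul X fun d => (U d)ᵀ, hU, rfl, ?_, fun d k k' hk => ?_, fun d k => ?_⟩
  · rw [tuckerMul_tuckerMul, tuckerMul_eq_mulVec]
    simp only [hU, piKron_one, Matrix.one_mulVec]
  · exact (congrFun₂ (hG d) k k').trans (Matrix.diagonal_apply_ne _ hk)
  · have h := (congrFun₂ (hG d) k k).trans (Matrix.diagonal_apply_eq _ k)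
    rw [Matrix.mul_apply] at h
    simp only [sq, modeSV, singularValues, ← h, Matrix.transpose_apply]
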